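/- Let X be a pure simplicial complex of rank n ≥ 2, regarded as a poset ordered by inclusion. Then: (1) if ΔX = ∅, X is an n-surface if and only if X is a normal pseudomanifold of rank n; (2) if ΔX ≠ ∅, X is an n-PCM if and only if X is a normal pseudomanifold of rank n. -/

import Mathlib

namespace PCMPaper

variable {α : Type*} [PartialOrder α]

/-- The set of elements of `X` strictly below `h` (α□_X(h)). -/
def alphaS (X : Set α) (h : α) : Set α := {x ∈ X | x < h}

/-- The set of elements of `X` strictly above `h` (β□_X(h)). -/
def betaS (X : Set α) (h : α) : Set α := {x ∈ X | h < x}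

/-- The (strict) neighborhood θ□_X(h) = α□_X(h) ∪ β□_X(h). -/
def thetaS (X : Set α) (h : α) : Set α := alphaS X h ∪ betaS X h

/-- The rank of `h` in the poset `X`: the maximal length of a strictly increasing
chain in `X` ending at `h`.  (It equals 0 when α□_X(h) = ∅ and
`max_{x ∈ α□_X(h)} rank X x + 1` otherwise, for finite `X`.) -/
noncomputable def rank (X : Set α) (h : α) : ℕ :=
  sSup {n : ℕ | ∃ c : Fin (n + 1) → α, StrictMono c ∧ (∀ i, c i ∈ X) ∧ c (Fin.last n) = h}

open scoped Classical in
/-- The rank of the poset `X`: maximal rank of its elements, `-1` if empty. -/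
noncomputable def rankSet (X : Set α) : ℤ :=
  if X = ∅ then -1 else ((sSup (rank X '' X) : ℕ) : ℤ)

/-- One step of a path in `X`: two distinct comparable elements of `X`. -/
def rel (X : Set α) (x y : α) : Prop :=
  x ∈ X ∧ y ∈ X ∧ x ≠ y ∧ (x < y ∨ y < x)

/-- `X` is (path-)connected: any two elements are joined by a path in `X`. -/
def IsConnected (X : Set α) : Prop :=
  ∀ x ∈ X, ∀ y ∈ X, Relation.ReflTransGen (rel X) x y

/-- `IsSurfaceAux (k + 1) X` means that `X` is a (discrete) `k`-surface. -/
def IsSurfaceAux : ℕ → Set α → Prop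
  | 0, X => X = ∅
  | 1, X => ∃ x y : α, x ≠ y ∧ ¬ x < y ∧ ¬ y < x ∧ X = {x, y}
  | (n + 2), X => X.Nonempty ∧ IsConnected X ∧ ∀ h ∈ X, IsSurfaceAux (n + 1) (thetaS X h)

/-- `X` is a discrete `k`-surface (`k : ℤ`, `k ≥ -1`). -/
def IsSurface (k : ℤ) (X : Set α) : Prop :=
  ∃ n : ℕ, (n : ℤ) = k + 1 ∧ IsSurfaceAux n X

/-- The border ΔX of a poset `X` of rank `n`:
elements whose neighborhood is not an `(n-1)`-surface. -/
def border (X : Set α) : Set α :=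
  {h ∈ X | ¬ IsSurface (rankSet X - 1) (thetaS X h)}

/-- The interior of `X`. -/
def interior' (X : Set α) : Set α := X \ border X

/-- `IsPCMAux (n + 1) X` means that `X` is an `n`-PCM. -/
def IsPCMAux : ℕ → Set α → Prop
  | 0, X => X = ∅
  | 1, X => ∃ x : α, X = {x}
  | (n + 2), X => rankSet X = ((n : ℤ) + 1) ∧ IsConnected X ∧ border X ≠ ∅ ∧
      ∀ h ∈ X, (h ∈ border X → IsPCMAux (n + 1) (thetaS X h)) ∧
               (h ∉ border X → IsSurfaceAux (n + 1) (thetaS X h))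

/-- `X` is an `k`-PCM (`k : ℤ`, `k ≥ -1`). -/
def IsPCM (k : ℤ) (X : Set α) : Prop :=
  ∃ n : ℕ, (n : ℤ) = k + 1 ∧ IsPCMAux n X

/-- Fuel-indexed coherence. -/
def IsCoherentAux : ℕ → Set α → Prop
  | 0, X => X = ∅
  | (n + 1), X => X = ∅ ∨
      ∀ h ∈ X, rankSet (thetaS X h) = rankSet X - 1 ∧ IsCoherentAux n (thetaS X h)

/-- `X` is a coherent poset. -/
def IsCoherent (X : Set α) : Prop := ∃ n : ℕ, IsCoherentAux n X

/-- `X` is a separated union of `(m-1)`-surfaces: a union of `(m-1)`-surfaces such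
that no element of one of them is comparable to an element of another one. -/
def IsSeparatedUnionOfSurfacesAux (m : ℕ) (X : Set α) : Prop :=
  ∃ P : Set (Set α), P.Nonempty ∧ X = ⋃₀ P ∧ (∀ S ∈ P, IsSurfaceAux m S) ∧
    ∀ S ∈ P, ∀ T ∈ P, S ≠ T → ∀ x ∈ S, ∀ y ∈ T, ¬ x ≤ y ∧ ¬ y ≤ x

/-- `IsSmoothPCMAux (n + 1) X` means that `X` is a smooth `n`-PCM. -/
def IsSmoothPCMAux : ℕ → Set α → Prop
  | 0, X => X = ∅
  | 1, X => ∃ x : α, X = {x}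
  | (n + 2), X => rankSet X = ((n : ℤ) + 1) ∧ IsConnected X ∧ border X ≠ ∅ ∧
      IsSeparatedUnionOfSurfacesAux (n + 1) (border X) ∧
      ∀ h ∈ X, IsSurfaceAux (n + 1) (thetaS X h) ∨ IsSmoothPCMAux (n + 1) (thetaS X h)

/-- `X` is a smooth `k`-PCM (`k : ℤ`, `k ≥ -1`). -/
def IsSmoothPCM (k : ℤ) (X : Set α) : Prop :=
  ∃ n : ℕ, (n : ℤ) = k + 1 ∧ IsSmoothPCMAux n X

/-- A simplicial complex: a finite family of nonempty finite sets, closed under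
taking nonempty subsets and under nonempty intersections. -/
def IsSimplicialComplex {V : Type*} [DecidableEq V] (X : Set (Finset V)) : Prop :=
  X.Finite ∧ (∀ h ∈ X, h.Nonempty) ∧
  (∀ h ∈ X, ∀ h' : Finset V, h'.Nonempty → h' ⊆ h → h' ∈ X) ∧
  (∀ h ∈ X, ∀ h' ∈ X, (h ∩ h').Nonempty → h ∩ h' ∈ X)

/-- The dimension of a simplex. -/
def dim {V : Type*} (h : Finset V) : ℤ := (h.card : ℤ) - 1

/-- The link of a simplex `h` in a family of simplices `S`. -/
def link {V : Type*} [DecidableEq V] (h : Finset V) (S : Set (Finset V)) : Set (Finset V) :=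
  {h' ∈ S | h ∩ h' = ∅ ∧ h ∪ h' ∈ S}

/-- `X` is pure of rank `n`: every simplex is contained in an `n`-dimensional one. -/
def Pure {V : Type*} (X : Set (Finset V)) (n : ℤ) : Prop :=
  ∀ h ∈ X, ∃ g ∈ X, h ⊆ g ∧ dim g = n

/-- Any two `n`-simplices of `X` are joined by a path in `X` all of whose elements
are simplices of dimension `n - 1` or `n` (i.e. `X` is `(n-1)`-connected). -/
def NConnected {V : Type*} (X : Set (Finset V)) (n : ℤ) : Prop :=
  ∀ a ∈ X, dim a = n → ∀ b ∈ X, dim b = n →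
    Relation.ReflTransGen (rel {h | h ∈ X ∧ (dim h = n - 1 ∨ dim h = n)}) a b

/-- `X` is a pseudomanifold of rank `n`. -/
def IsPseudomanifold {V : Type*} [DecidableEq V] (X : Set (Finset V)) (n : ℤ) : Prop :=
  IsSimplicialComplex X ∧ rankSet X = n ∧
  ((n = 0 ∧ ∃ v : V, X = {({v} : Finset V)}) ∨
   (1 ≤ n ∧ Pure X n ∧
    (∀ h ∈ X, dim h = n - 1 →
      Set.ncard {g | g ∈ X ∧ h ⊆ g ∧ dim g = n} ∈ ({1, 2} : Set ℕ)) ∧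
    NConnected X n))

/-- `X` is a normal pseudomanifold of rank `n`: a pseudomanifold such that the link
of every simplex of dimension at most `n - 2` is a pseudomanifold. -/
def IsNormalPseudomanifold {V : Type*} [DecidableEq V] (X : Set (Finset V)) (n : ℤ) : Prop :=
  IsPseudomanifold X n ∧
  ∀ h ∈ X, dim h ≤ n - 2 → IsPseudomanifold (link h X) (n - dim h - 1)

/-- `IsGSurfaceAux (k + 1) X` means that `X` is a `k`-surface or a `k`-PCM
(see `isGSurfaceAux_iff`). -/
def IsGSurfaceAux : ℕ → Set α → Prop
  | 0, X => X = ∅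
  | 1, X => ∃ x y : α, ¬ x < y ∧ ¬ y < x ∧ X = {x, y}
  | (n + 2), X => X.Nonempty ∧ IsConnected X ∧ ∀ h ∈ X, IsGSurfaceAux (n + 1) (thetaS X h)

/-- The longest chains of `X` have exactly `m` elements. -/
def HasHeight (m : ℕ) (X : Set α) : Prop :=
  (∃ C : Finset α, ↑C ⊆ X ∧ IsChain (· ≤ ·) (C : Set α) ∧ C.card = m) ∧
  ∀ C : Finset α, ↑C ⊆ X → IsChain (· ≤ ·) (C : Set α) → C.card ≤ m

lemma rel_symm {X : Set α} {x y : α} (h : rel X x y) : rel X y x :=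
  ⟨h.2.1, h.1, h.2.2.1.symm, h.2.2.2.symm⟩

lemma rel_of_lt {X : Set α} {x y : α} (hx : x ∈ X) (hy : y ∈ X) (h : x < y) : rel X x y :=
  ⟨hx, hy, h.ne, Or.inl h⟩

lemma rel_mono {X Y : Set α} (hXY : X ⊆ Y) {x y : α} (h : rel X x y) : rel Y x y :=
  ⟨hXY h.1, hXY h.2.1, h.2.2⟩

lemma reflTransGen_rel_symm {X : Set α} {x y : α} (h : Relation.ReflTransGen (rel X) x y) :
    Relation.ReflTransGen (rel X) y x :=
  have : Std.Symm (rel X) := ⟨fun _ _ => rel_symm⟩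
  Std.Symm.symm _ _ h

lemma reflTransGen_rel_mono {X Y : Set α} (hXY : X ⊆ Y) {x y : α}
    (h : Relation.ReflTransGen (rel X) x y) : Relation.ReflTransGen (rel Y) x y :=
  h.lift id fun _ _ => rel_mono hXY

lemma mem_thetaS {X : Set α} {h x : α} : x ∈ thetaS X h ↔ x ∈ X ∧ (x < h ∨ h < x) := by
  simp only [thetaS, alphaS, betaS, Set.mem_union, Set.mem_ofPred_eq]
  tauto

lemma IsGSurfaceAux.nonempty {m : ℕ} {X : Set α} (h : IsGSurfaceAux (m + 1) X) :
    X.Nonempty := by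
  cases m with
  | zero =>
    obtain ⟨x, y, -, -, rfl⟩ := h
    exact ⟨x, by simp⟩
  | succ m => exact h.1

lemma IsGSurfaceAux.thetaS {m : ℕ} {X : Set α} (hX : IsGSurfaceAux (m + 1) X) {h : α}
    (hh : h ∈ X) : IsGSurfaceAux m (thetaS X h) := by
  cases m with
  | zero =>
    obtain ⟨x, y, hxy, hyx, rfl⟩ := hX
    change PCMPaper.thetaS _ _ = ∅
    ext z
    simp only [mem_thetaS, Set.mem_insert_iff, Set.mem_singleton_iff, Set.mem_empty_iff_false,
      iff_false] at hh ⊢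
    rintro ⟨rfl | rfl, hz⟩ <;> rcases hh with rfl | rfl <;> simp_all
  | succ m => exact hX.2.2 h hh

lemma HasHeight.succ {m : ℕ} {X : Set α} (hne : X.Nonempty)
    (hX : ∀ h ∈ X, HasHeight m (thetaS X h)) : HasHeight (m + 1) X := by
  classical
  constructor
  · obtain ⟨h, hh⟩ := hne
    obtain ⟨⟨C, hC, hchain, hcard⟩, -⟩ := hX h hh
    refine ⟨insert h C, ?_, ?_, ?_⟩
    · intro x hx
      rcases Finset.mem_insert.1 (Finset.mem_coe.1 hx) with rfl | hx
      · exact hh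
      · exact (mem_thetaS.1 (hC hx)).1
    · rw [Finset.coe_insert]
      refine hchain.insert fun b hb _ => ?_
      exact (mem_thetaS.1 (hC hb)).2.symm.imp le_of_lt le_of_lt
    · rw [Finset.card_insert_of_notMem, hcard]
      intro hmem
      have := mem_thetaS.1 (hC hmem)
      simp at this
  · intro C hC hchain
    rcases C.eq_empty_or_nonempty with rfl | ⟨h, hh⟩
    · simp
    · have := (hX h (hC hh)).2 (C.erase h) ?_ ?_
      · rw [Finset.card_erase_of_mem hh] at this
        omega
      · intro x hx
        have hx' := Finset.mem_erase.1 (Finset.mem_coe.1 hx)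
        refine mem_thetaS.2 ⟨hC hx'.2, ?_⟩
        exact (hchain hx'.2 hh hx'.1).imp (fun h => lt_of_le_of_ne h hx'.1)
          (fun h => lt_of_le_of_ne h hx'.1.symm)
      · exact hchain.mono (by simp)

lemma IsGSurfaceAux.hasHeight {m : ℕ} : ∀ {X : Set α}, IsGSurfaceAux m X → HasHeight m X := by
  induction m with
  | zero =>
    intro X hX
    obtain rfl : X = ∅ := hX
    refine ⟨⟨∅, by simp⟩, fun C hC _ => ?_⟩
    have : C = ∅ := by simpa using hC
    simp [this]
  | succ m ih => exact fun hX => .succ hX.nonempty fun h hh => ih (hX.thetaS hh)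

lemma exists_strictMono_of_isChain {m : ℕ} : ∀ {C : Finset α}, IsChain (· ≤ ·) (C : Set α) →
    C.card = m → ∃ c : Fin m → α, StrictMono c ∧ ∀ i, c i ∈ C := by
  intro C hC hm
  classical
  let _ : LinearOrder C :=
    { (inferInstance : PartialOrder C) with
      le_total := fun a b => hC.total a.2 b.2
      toDecidableLE := Classical.decRel _ }
  let e := (Finset.univ : Finset C).orderEmbOfFin (k := m) (by simpa using hm)
  exact ⟨fun i => (e i : α), fun i j hij => e.strictMono hij, fun i => (e i).2⟩

lemma HasHeight.rankSet_eq {m : ℕ} {X : Set α} (h : HasHeight (m + 1) X) :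
    rankSet X = m := by
  classical
  obtain ⟨⟨C, hC, hchain, hcard⟩, hle⟩ := h
  obtain ⟨c, hc, hcC⟩ := exists_strictMono_of_isChain hchain hcard
  have hbdd : ∀ x, ∀ k ∈ {n : ℕ | ∃ c : Fin (n + 1) → α, StrictMono c ∧ (∀ i, c i ∈ X) ∧
      c (Fin.last n) = x}, k ≤ m := by
    rintro x k ⟨c, hc, hcX, -⟩
    have := hle (Finset.univ.image c) (by intro y; simp; rintro i rfl; exact hcX i) ?_
    · rw [Finset.card_image_of_injective _ hc.injective] at this
      simpa using this
    · intro a ha b hb _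
      simp only [Finset.coe_image, Finset.coe_univ, Set.image_univ, Set.mem_range] at ha hb
      obtain ⟨i, rfl⟩ := ha
      obtain ⟨j, rfl⟩ := hb
      exact (le_total i j).imp (fun h => hc.monotone h) (fun h => hc.monotone h)
  have hrank : ∀ x, rank X x ≤ m := fun x => csSup_le' (hbdd x)
  have htop : m ≤ rank X (c (Fin.last m)) :=
    le_csSup ⟨m, hbdd _⟩ ⟨c, hc, fun i => hC (hcC i), rfl⟩
  have hmem : c (Fin.last m) ∈ X := hC (hcC _)
  have hne : X ≠ ∅ := fun h => by simp [h] at hmem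
  rw [rankSet, if_neg hne]
  congr 1
  refine le_antisymm (csSup_le' ?_) (htop.trans (le_csSup ⟨m, ?_⟩ ⟨_, hmem, rfl⟩))
  all_goals
    rintro _ ⟨x, -, rfl⟩
    exact hrank x

lemma isSurface_iff {m : ℕ} {k : ℤ} (hk : (m : ℤ) = k + 1) {X : Set α} :
    IsSurface k X ↔ IsSurfaceAux m X := by
  constructor
  · rintro ⟨n, hn, h⟩
    obtain rfl : n = m := by omega
    exact h
  · exact fun h => ⟨m, hk, h⟩

lemma isPCM_iff {m : ℕ} {k : ℤ} (hk : (m : ℤ) = k + 1) {X : Set α} :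
    IsPCM k X ↔ IsPCMAux m X := by
  constructor
  · rintro ⟨n, hn, h⟩
    obtain rfl : n = m := by omega
    exact h
  · exact fun h => ⟨m, hk, h⟩

lemma mem_border_iff {m : ℕ} {X : Set α} (hX : rankSet X = m) {h : α} :
    h ∈ border X ↔ h ∈ X ∧ ¬ IsSurfaceAux m (thetaS X h) := by
  simp only [border, Set.mem_ofPred_eq, hX, isSurface_iff (show (m : ℤ) = (m : ℤ) - 1 + 1 by ring)]

/-- A poset is a `(m - 1)`-PCM or a `(m - 1)`-surface iff it satisfies the recursive condition
`IsGSurfaceAux m`. -/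
lemma isGSurfaceAux_iff {m : ℕ} :
    ∀ {X : Set α}, IsGSurfaceAux m X ↔ IsPCMAux m X ∨ IsSurfaceAux m X := by
  induction m with
  | zero => exact fun {X} => (or_self_iff).symm
  | succ m ih =>
    cases m with
    | zero =>
      intro X
      constructor
      · rintro ⟨x, y, hxy, hyx, rfl⟩
        by_cases h : x = y
        · subst h
          exact Or.inl ⟨x, by simp⟩
        · exact Or.inr ⟨x, y, h, hxy, hyx, rfl⟩
      · rintro (⟨x, rfl⟩ | ⟨x, y, h, hxy, hyx, rfl⟩)
        · exact ⟨x, x, by simp⟩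
        · exact ⟨x, y, hxy, hyx, rfl⟩
    | succ m =>
      intro X
      constructor
      · intro hX
        have hrk : rankSet X = ((m + 1 : ℕ) : ℤ) := hX.hasHeight.rankSet_eq
        by_cases hb : border X = ∅
        · refine Or.inr ⟨hX.1, hX.2.1, fun h hh => ?_⟩
          by_contra hcon
          have : h ∈ border X := (mem_border_iff hrk).2 ⟨hh, hcon⟩
          simp [hb] at this
        · refine Or.inl ⟨by exact_mod_cast hrk, hX.2.1, hb,
            fun h hh => ⟨fun hhb => ?_, fun hhb => ?_⟩⟩
          · exact (ih.1 (hX.2.2 h hh)).resolve_right ((mem_border_iff hrk).1 hhb).2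
          · by_contra hcon
            exact hhb ((mem_border_iff hrk).2 ⟨hh, hcon⟩)
      · rintro (⟨hrk, hconn, hb, hX⟩ | ⟨hne, hconn, hX⟩)
        · obtain ⟨x, hx⟩ := Set.nonempty_iff_ne_empty.2 hb
          refine ⟨⟨x, hx.1⟩, hconn, fun h hh => ih.2 ?_⟩
          by_cases hhb : h ∈ border X
          · exact Or.inl ((hX h hh).1 hhb)
          · exact Or.inr ((hX h hh).2 hhb)
        · exact ⟨hne, hconn, fun h hh => ih.2 (Or.inr (hX h hh))⟩

lemma isConnected_union_of_lt {A B : Set α} (hA : A.Nonempty) (hB : B.Nonempty)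
    (hlt : ∀ a ∈ A, ∀ b ∈ B, a < b) : IsConnected (A ∪ B) := by
  have key : ∀ a ∈ A, ∀ b ∈ B, Relation.ReflTransGen (rel (A ∪ B)) a b := fun a ha b hb =>
    .single (rel_of_lt (Or.inl ha) (Or.inr hb) (hlt a ha b hb))
  obtain ⟨a, ha⟩ := hA
  obtain ⟨b, hb⟩ := hB
  rintro x (hx | hx) y (hy | hy)
  · exact (key x hx b hb).trans (reflTransGen_rel_symm (key y hy b hb))
  · exact key x hx y hy
  · exact reflTransGen_rel_symm (key y hy x hx)
  · exact (reflTransGen_rel_symm (key a ha x hx)).trans (key a ha y hy)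

/-- The ordinal sum of a `(k - 1)`- and an `(l - 1)`-dimensional generalized surface. -/
lemma IsGSurfaceAux.union {N : ℕ} : ∀ {k l : ℕ} {A B : Set α}, k + l = N → IsGSurfaceAux k A →
    IsGSurfaceAux l B → (∀ a ∈ A, ∀ b ∈ B, a < b) → IsGSurfaceAux N (A ∪ B) := by
  induction N with
  | zero =>
    intro k l A B hN hA hB _
    obtain ⟨rfl, rfl⟩ : k = 0 ∧ l = 0 := by omega
    obtain rfl : A = ∅ := hA
    obtain rfl : B = ∅ := hB
    exact Set.union_empty _
  | succ N ih =>
    intro k l A B hN hA hB hlt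
    rcases k with _ | k
    · obtain rfl : A = ∅ := hA
      obtain rfl : l = N + 1 := by omega
      simpa using hB
    rcases l with _ | l
    · obtain rfl : B = ∅ := hB
      obtain rfl : k = N := by omega
      simpa using hA
    obtain rfl : N = (k + l) + 1 := by omega
    refine ⟨hA.nonempty.inl, isConnected_union_of_lt hA.nonempty hB.nonempty hlt, ?_⟩
    rintro h (hh | hh)
    · have : PCMPaper.thetaS (A ∪ B) h = PCMPaper.thetaS A h ∪ B := by
        ext x
        simp only [mem_thetaS, Set.mem_union]
        have : x ∈ B → h < x := hlt h hh x
        tauto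
      rw [this]
      exact ih (by omega) (hA.thetaS hh) hB fun a ha b hb => hlt a (mem_thetaS.1 ha).1 b hb
    · have : PCMPaper.thetaS (A ∪ B) h = A ∪ PCMPaper.thetaS B h := by
        ext x
        simp only [mem_thetaS, Set.mem_union]
        have : x ∈ A → x < h := fun hx => hlt x hx h hh
        tauto
      rw [this]
      exact ih (by omega) hA (hB.thetaS hh) fun a ha b hb => hlt a ha b (mem_thetaS.1 hb).1

section Simplicial

variable {V : Type*}

/-- Every simplex of `X` is contained in one with `N + 1` vertices. -/
def PureCard (X : Set (Finset V)) (N : ℕ) : Prop :=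
  ∀ h ∈ X, ∃ g ∈ X, h ⊆ g ∧ g.card = N + 1

lemma PureCard.card_le {X : Set (Finset V)} {N : ℕ} (hX : PureCard X N) {h : Finset V}
    (hh : h ∈ X) : h.card ≤ N + 1 := by
  obtain ⟨g, -, hg, hc⟩ := hX h hh
  exact hc ▸ Finset.card_le_card hg

lemma PureCard.exists_facet {X : Set (Finset V)} {N : ℕ} (hX : PureCard X N) (hne : X.Nonempty)
    {s : Finset V} (hs : s ∈ X ∨ s = ∅) : ∃ g ∈ X, s ⊆ g ∧ g.card = N + 1 := by
  rcases hs with hs | rfl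
  · exact hX s hs
  · obtain ⟨h, hh⟩ := hne
    obtain ⟨g, hg, -, hc⟩ := hX h hh
    exact ⟨g, hg, by simp, hc⟩

lemma mem_betaS {X : Set (Finset V)} {s x : Finset V} : x ∈ betaS X s ↔ x ∈ X ∧ s ⊂ x := Iff.rfl

/-- Any two simplices of `X` with `N + 1` vertices containing `s` are joined by a path through
simplices containing `s` with `N` or `N + 1` vertices. -/
def StarConnected (X : Set (Finset V)) (N : ℕ) (s : Finset V) : Prop :=
  ∀ a ∈ X, s ⊆ a → a.card = N + 1 → ∀ b ∈ X, s ⊆ b → b.card = N + 1 →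
    Relation.ReflTransGen (rel {h | h ∈ X ∧ s ⊆ h ∧ (h.card = N ∨ h.card = N + 1)}) a b

/-- Every ridge of `X` (a simplex with `N` vertices) lies in one or two simplices with `N + 1`
vertices. -/
def RidgeCondition (X : Set (Finset V)) (N : ℕ) : Prop :=
  ∀ h ∈ X, h.card = N → Set.ncard {g | g ∈ X ∧ h ⊆ g ∧ g.card = N + 1} ∈ ({1, 2} : Set ℕ)

lemma betaS_eq_of_card_eq {X : Set (Finset V)} {N : ℕ} (hpure : PureCard X N) {s : Finset V}
    (hs : s.card = N) : betaS X s = {g | g ∈ X ∧ s ⊆ g ∧ g.card = N + 1} := by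
  ext g
  simp only [mem_betaS, Set.mem_ofPred_eq]
  constructor
  · rintro ⟨hg, hsg⟩
    have h1 := Finset.card_lt_card hsg
    have h2 := hpure.card_le hg
    exact ⟨hg, hsg.subset, by omega⟩
  · rintro ⟨hg, hsg, hc⟩
    refine ⟨hg, Finset.ssubset_iff_subset_ne.2 ⟨hsg, ?_⟩⟩
    rintro rfl
    omega

lemma starConnected_of_isGSurfaceAux {X : Set (Finset V)} {N : ℕ} (hpure : PureCard X N)
    (hN : 1 ≤ N)
    (hG : ∀ (m : ℕ) (s : Finset V), s ∈ X ∨ s = ∅ → s.card + m = N + 1 →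
      IsGSurfaceAux m (betaS X s)) {m : ℕ} :
    ∀ {s : Finset V}, s ∈ X ∨ s = ∅ → s.card + m = N + 1 → StarConnected X N s := by
  induction m using Nat.strong_induction_on with
  | _ m ih =>
  intro s hs hcard a ha hsa hac b hb hsb hbc
  rcases m with _ | _ | m
  · have h1 := Finset.eq_of_subset_of_card_le hsa (by omega)
    have h2 := Finset.eq_of_subset_of_card_le hsb (by omega)
    rw [← h1, ← h2]
  · have hsX : s ∈ X := hs.resolve_right fun h => by simp [h] at hcard; omega
    have hlt : ∀ {x}, s ⊆ x → x.card = N + 1 → s < x := fun {x} hsx hc =>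
      Finset.ssubset_iff_subset_ne.2 ⟨hsx, by rintro rfl; omega⟩
    have hmem : s ∈ {h | h ∈ X ∧ s ⊆ h ∧ (h.card = N ∨ h.card = N + 1)} :=
      ⟨hsX, subset_rfl, by omega⟩
    exact .trans (.single (rel_symm (rel_of_lt hmem ⟨ha, hsa, Or.inr hac⟩ (hlt hsa hac))))
      (.single (rel_of_lt hmem ⟨hb, hsb, Or.inr hbc⟩ (hlt hsb hbc)))
  · have hmem : ∀ x ∈ X, s ⊆ x → x.card = N + 1 → x ∈ betaS X s := fun x hx hsx hc =>
      ⟨hx, Finset.ssubset_iff_subset_ne.2 ⟨hsx, by rintro rfl; omega⟩⟩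
    suffices ∀ y, Relation.ReflTransGen (rel (betaS X s)) a y → ∀ g ∈ X, y ⊆ g → g.card = N + 1 →
        Relation.ReflTransGen
          (rel {h | h ∈ X ∧ s ⊆ h ∧ (h.card = N ∨ h.card = N + 1)}) a g from
      this b ((hG _ s hs hcard).2.1 a (hmem a ha hsa hac) b (hmem b hb hsb hbc)) b hb subset_rfl hbc
    intro y hy
    induction hy with
    | refl =>
      intro g hg hag hgc
      rw [Finset.eq_of_subset_of_card_le hag (by omega)]
    | @tail y z _ hyz IH =>
      intro g hg hzg hgc
      obtain ⟨hyX, hzX, -, hlt | hlt⟩ := hyz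
      · exact IH g hg (hlt.subset.trans hzg) hgc
      · obtain ⟨k, hk, hyk, hkc⟩ := hpure y hyX.1
        refine (IH k hk hyk hkc).trans ?_
        have h1 := Finset.card_lt_card hzX.2
        have h2 := hpure.card_le hzX.1
        refine reflTransGen_rel_mono ?_ (ih (N + 1 - z.card) (by omega) (Or.inl hzX.1) (by omega)
          k hk (hlt.subset.trans hyk) hkc g hg hzg hgc)
        exact fun w hw => ⟨hw.1, hzX.2.subset.trans hw.2.1, hw.2.2⟩

lemma pure_iff {X : Set (Finset V)} {N : ℕ} : Pure X N ↔ PureCard X N := by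
  refine forall₂_congr fun h _ => exists_congr fun g => and_congr_right fun _ =>
    and_congr_right fun _ => ?_
  unfold dim
  omega

lemma ridgeCondition_iff {X : Set (Finset V)} {N : ℕ} : RidgeCondition X N ↔
    ∀ h ∈ X, dim h = (N : ℤ) - 1 →
      Set.ncard {g | g ∈ X ∧ h ⊆ g ∧ dim g = N} ∈ ({1, 2} : Set ℕ) := by
  have h1 : ∀ g : Finset V, dim g = N ↔ g.card = N + 1 := fun g => by unfold dim; omega
  have h2 : ∀ g : Finset V, dim g = (N : ℤ) - 1 ↔ g.card = N := fun g => by unfold dim; omega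
  simp only [RidgeCondition, h1, h2]

variable [DecidableEq V]

/-- A proper open interval of a Boolean lattice is a sphere. -/
lemma isGSurfaceAux_Ioo {m : ℕ} : ∀ {s t : Finset V}, s ⊆ t → t.card = s.card + m + 1 →
    IsGSurfaceAux m (Set.Ioo s t) := by
  induction m using Nat.strong_induction_on with
  | _ m ih =>
  intro s t hst hcard
  have hmem : ∀ u ⊆ t, s ⊂ u → u.card < t.card → u ∈ Set.Ioo s t := fun u h1 h2 h3 =>
    ⟨h2, Finset.ssubset_iff_subset_ne.2 ⟨h1, fun h => by simp [h] at h3⟩⟩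
  have hins : ∀ x ∈ Set.Ioo s t, ∃ c ∈ t \ s, insert c s ⊆ x := by
    intro x hx
    obtain ⟨c, hcx, hcs⟩ := Finset.exists_of_ssubset hx.1
    exact ⟨c, Finset.mem_sdiff.2 ⟨hx.2.subset hcx, hcs⟩, Finset.insert_subset hcx hx.1.subset⟩
  rcases m with _ | _ | m
  · change Set.Ioo s t = ∅
    ext x
    simp only [Set.mem_Ioo, Set.mem_empty_iff_false, iff_false, not_and]
    intro h1 h2
    have := Finset.card_lt_card h1
    have := Finset.card_lt_card h2
    omega
  · have h2 : (t \ s).card = 2 := by rw [Finset.card_sdiff_of_subset hst]; omega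
    obtain ⟨a, b, hab, hts⟩ := Finset.card_eq_two.1 h2
    have ha : a ∈ t \ s := by simp [hts]
    have hb : b ∈ t \ s := by simp [hts]
    rw [Finset.mem_sdiff] at ha hb
    refine ⟨insert a s, insert b s, ?_, ?_, ?_⟩
    · intro h
      have := Finset.card_lt_card h
      simp [ha.2, hb.2] at this
    · intro h
      have := Finset.card_lt_card h
      simp [ha.2, hb.2] at this
    · ext x
      constructor
      · intro hx
        obtain ⟨c, hc, hcx⟩ := hins x hx
        have hlt := Finset.card_lt_card hx.2
        have : insert c s = x := Finset.eq_of_subset_of_card_le hcx (by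
          rw [Finset.card_insert_of_notMem (Finset.mem_sdiff.1 hc).2]; omega)
        rw [hts] at hc
        simp only [Finset.mem_insert, Finset.mem_singleton] at hc
        rcases hc with rfl | rfl <;> simp [← this]
      · rintro (rfl | rfl)
        · exact hmem _ (Finset.insert_subset ha.1 hst) (Finset.ssubset_insert ha.2)
            (by rw [Finset.card_insert_of_notMem ha.2]; omega)
        · exact hmem _ (Finset.insert_subset hb.1 hst) (Finset.ssubset_insert hb.2)
            (by rw [Finset.card_insert_of_notMem hb.2]; omega)
  · have hins_mem : ∀ c ∈ t \ s, insert c s ∈ Set.Ioo s t := by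
      intro c hc
      rw [Finset.mem_sdiff] at hc
      exact hmem _ (Finset.insert_subset hc.1 hst) (Finset.ssubset_insert hc.2)
        (by rw [Finset.card_insert_of_notMem hc.2]; omega)
    have hstep : ∀ x ∈ Set.Ioo s t, ∀ y ∈ Set.Ioo s t, x ⊆ y →
        Relation.ReflTransGen (rel (Set.Ioo s t)) x y := by
      intro x hx y hy hxy
      rcases hxy.eq_or_ssubset with rfl | hxy
      · exact .refl
      · exact .single (rel_of_lt hx hy hxy)
    refine ⟨?_, ?_, ?_⟩
    · obtain ⟨c, hc⟩ : (t \ s).Nonempty := by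
        rw [← Finset.card_pos, Finset.card_sdiff_of_subset hst]
        omega
      exact ⟨_, hins_mem c hc⟩
    · intro x hx y hy
      obtain ⟨a, ha, hax⟩ := hins x hx
      obtain ⟨b, hb, hby⟩ := hins y hy
      have hu : insert a (insert b s) ∈ Set.Ioo s t := by
        have ha' := Finset.mem_sdiff.1 ha
        have hb' := Finset.mem_sdiff.1 hb
        refine hmem _ (Finset.insert_subset ha'.1 (Finset.insert_subset hb'.1 hst))
          ((Finset.ssubset_insert hb'.2).trans_subset (Finset.subset_insert _ _)) ?_
        have h1 := Finset.card_insert_le a (insert b s)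
        have h2 := Finset.card_insert_le b s
        omega
      have h1 := reflTransGen_rel_symm (hstep _ (hins_mem a ha) x hx hax)
      have h2 := hstep _ (hins_mem b hb) y hy hby
      have h3 := hstep _ (hins_mem a ha) _ hu
        (Finset.insert_subset_insert _ (Finset.subset_insert _ _))
      have h4 := reflTransGen_rel_symm (hstep _ (hins_mem b hb) _ hu (Finset.subset_insert _ _))
      exact ((h1.trans h3).trans h4).trans h2
    · intro x hx
      have : thetaS (Set.Ioo s t) x = Set.Ioo s x ∪ Set.Ioo x t := by
        ext y
        simp only [mem_thetaS, Set.mem_union, Set.mem_Ioo]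
        have h1 : y < x → y < t := fun h => h.trans hx.2
        have h2 : x < y → s < y := fun h => hx.1.trans h
        tauto
      rw [this]
      have h1 := Finset.card_lt_card hx.1
      have h2 := Finset.card_lt_card hx.2
      exact (ih (x.card - s.card - 1) (by omega) hx.1.subset (by omega)).union
        (l := t.card - x.card - 1) (by omega) (ih _ (by omega) hx.2.subset (by omega))
        fun a ha b hb => ha.2.trans hb.1

lemma IsSimplicialComplex.thetaS_betaS {X : Set (Finset V)} (hX : IsSimplicialComplex X)
    {s h : Finset V} (hh : h ∈ betaS X s) :
    thetaS (betaS X s) h = Set.Ioo s h ∪ betaS X h := by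
  ext y
  simp only [mem_thetaS, Set.mem_union, Set.mem_Ioo, mem_betaS]
  constructor
  · tauto
  · rintro (⟨h1, h2⟩ | ⟨h1, h2⟩)
    · refine ⟨⟨hX.2.2.1 h hh.1 y ?_ h2.subset, h1⟩, Or.inl h2⟩
      exact Finset.card_pos.1 ((Nat.zero_le _).trans_lt (Finset.card_lt_card h1))
    · exact ⟨⟨h1, hh.2.trans h2⟩, Or.inr h2⟩

lemma isGSurfaceAux_betaS {X : Set (Finset V)} {N : ℕ} (hX : IsSimplicialComplex X)
    (hne : X.Nonempty) (hpure : PureCard X N) (hN : 1 ≤ N) (hridge : RidgeCondition X N)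
    (hstar : ∀ s, s ∈ X ∨ s = ∅ → s.card < N → StarConnected X N s) {m : ℕ} :
    ∀ {s : Finset V}, s ∈ X ∨ s = ∅ → s.card + m = N + 1 → IsGSurfaceAux m (betaS X s) := by
  induction m using Nat.strong_induction_on with
  | _ m ih =>
  intro s hs hcard
  rcases m with _ | _ | m
  · change betaS X s = ∅
    ext x
    simp only [mem_betaS, Set.mem_empty_iff_false, iff_false, not_and]
    intro hx hsx
    have := hpure.card_le hx
    have := Finset.card_lt_card hsx
    omega
  · have hsX : s ∈ X := hs.resolve_right fun h => by simp [h] at hcard; omega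
    have hncard := hridge s hsX (by omega)
    have hc : ∀ x ∈ {g | g ∈ X ∧ s ⊆ g ∧ g.card = N + 1}, x.card = N + 1 := fun x hx => hx.2.2
    rw [betaS_eq_of_card_eq hpure (by omega)]
    set Y := {g | g ∈ X ∧ s ⊆ g ∧ g.card = N + 1}
    obtain ⟨x, y, hxy⟩ : ∃ x y, Y = {x, y} := by
      rcases hncard with h | h
      · obtain ⟨x, hx⟩ := Set.ncard_eq_one.1 h
        exact ⟨x, x, by simp [hx]⟩
      · obtain ⟨x, y, -, hxy⟩ := Set.ncard_eq_two.1 h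
        exact ⟨x, y, hxy⟩
    have hx := hc x (by simp [hxy])
    have hy := hc y (by simp [hxy])
    refine ⟨x, y, fun h => ?_, fun h => ?_, hxy⟩ <;> have := Finset.card_lt_card h <;> omega
  · have htop : ∀ x ∈ X, s ⊆ x → N ≤ x.card → x ∈ betaS X s := fun x hx hsx hc =>
      ⟨hx, Finset.ssubset_iff_subset_ne.2 ⟨hsx, by rintro rfl; omega⟩⟩
    refine ⟨?_, ?_, ?_⟩
    · obtain ⟨g, hg, hsg, hc⟩ := hpure.exists_facet hne hs
      exact ⟨g, htop g hg hsg (by omega)⟩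
    · have hup : ∀ x ∈ betaS X s, ∃ g ∈ X, s ⊆ g ∧ g.card = N + 1 ∧
          Relation.ReflTransGen (rel (betaS X s)) x g := by
        intro x hx
        obtain ⟨g, hg, hxg, hc⟩ := hpure x hx.1
        have hsg := hx.2.subset.trans hxg
        refine ⟨g, hg, hsg, hc, ?_⟩
        rcases hxg.eq_or_ssubset with rfl | hlt
        · exact .refl
        · exact .single (rel_of_lt hx (htop g hg hsg (by omega)) hlt)
      intro x hx y hy
      obtain ⟨g, hg, hsg, hgc, hxg⟩ := hup x hx
      obtain ⟨k, hk, hsk, hkc, hyk⟩ := hup y hy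
      refine (hxg.trans ?_).trans (reflTransGen_rel_symm hyk)
      refine reflTransGen_rel_mono ?_ (hstar s hs (by omega) g hg hsg hgc k hk hsk hkc)
      rintro z ⟨hz, hsz, hzc⟩
      exact htop z hz hsz (by omega)
    · intro h hh
      have h1 := Finset.card_lt_card hh.2
      have h2 := hpure.card_le hh.1
      rw [hX.thetaS_betaS hh]
      exact (isGSurfaceAux_Ioo (m := h.card - s.card - 1) hh.2.subset (by omega)).union
        (l := N + 1 - h.card) (by omega) (ih _ (by omega) (Or.inl hh.1) (by omega))
        fun a ha b hb => ha.2.trans hb.2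

lemma IsSimplicialComplex.betaS_empty {X : Set (Finset V)} (hX : IsSimplicialComplex X) :
    betaS X ∅ = X := by
  ext x
  simp only [mem_betaS, Finset.empty_ssubset]
  exact ⟨fun h => h.1, fun h => ⟨h, hX.2.1 x h⟩⟩

lemma isGSurfaceAux_betaS_of_isGSurfaceAux {X : Set (Finset V)} {N : ℕ}
    (hX : IsSimplicialComplex X) (hG : IsGSurfaceAux (N + 1) X) {k : ℕ} :
    ∀ {m : ℕ} {s : Finset V}, s ∈ X ∨ s = ∅ → s.card = k → k + m = N + 1 →
      IsGSurfaceAux m (betaS X s) := by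
  induction k with
  | zero =>
    intro m s _ hs hm
    obtain rfl : m = N + 1 := by omega
    rwa [Finset.card_eq_zero.1 hs, hX.betaS_empty]
  | succ k ih =>
    intro m s hs hk hm
    have hsX : s ∈ X := hs.resolve_right fun h => by simp [h] at hk
    obtain ⟨a, ha⟩ := Finset.card_pos.1 (by omega : 0 < s.card)
    have hcard : (s.erase a).card = k := by rw [Finset.card_erase_of_mem ha]; omega
    have hsub := Finset.erase_ssubset ha
    have hmem : s.erase a ∈ X ∨ s.erase a = ∅ := by
      rcases (s.erase a).eq_empty_or_nonempty with h | h
      · exact Or.inr h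
      · exact Or.inl (hX.2.2.1 s hsX _ h hsub.subset)
    have hs' : s ∈ betaS X (s.erase a) := ⟨hsX, hsub⟩
    have := (ih (m := m + 1) hmem hcard (by omega)).thetaS hs'
    rw [hX.thetaS_betaS hs'] at this
    have hIoo : Set.Ioo (s.erase a) s = ∅ :=
      isGSurfaceAux_Ioo (m := 0) hsub.subset (by omega)
    rwa [hIoo, Set.empty_union] at this

lemma RidgeCondition.of_isGSurfaceAux {X : Set (Finset V)} {N : ℕ} (hpure : PureCard X N)
    (hG : ∀ s ∈ X, s.card = N → IsGSurfaceAux 1 (betaS X s)) : RidgeCondition X N := by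
  intro h hh hc
  obtain ⟨x, y, -, -, hxy⟩ := hG h hh hc
  rw [← betaS_eq_of_card_eq hpure hc, hxy]
  by_cases h : x = y
  · subst h
    simp
  · simp [Set.ncard_pair h]

lemma mem_link {X : Set (Finset V)} {s h : Finset V} :
    h ∈ link s X ↔ h ∈ X ∧ s ∩ h = ∅ ∧ s ∪ h ∈ X := Iff.rfl

lemma link_empty (X : Set (Finset V)) : link ∅ X = X := by
  ext x
  simp [mem_link]

lemma IsSimplicialComplex.link {X : Set (Finset V)} (hX : IsSimplicialComplex X)
    (s : Finset V) : IsSimplicialComplex (link s X) := by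
  have hsub : ∀ h ∈ PCMPaper.link s X, ∀ h' : Finset V, h'.Nonempty → h' ⊆ h →
      h' ∈ PCMPaper.link s X := by
    intro h hh h' hne hsub
    refine ⟨hX.2.2.1 h hh.1 h' hne hsub, ?_, ?_⟩
    · exact Finset.subset_empty.1 (hh.2.1 ▸ Finset.inter_subset_inter_left hsub)
    · exact hX.2.2.1 _ hh.2.2 _ (hne.mono Finset.subset_union_right)
        (Finset.union_subset_union_right hsub)
  exact ⟨hX.1.subset fun h hh => hh.1, fun h hh => hX.2.1 h hh.1, hsub,
    fun h hh h' _ hne => hsub h hh _ hne Finset.inter_subset_left⟩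

lemma IsSimplicialComplex.sdiff_mem_link {X : Set (Finset V)} (hX : IsSimplicialComplex X)
    {s g : Finset V} (hg : g ∈ X) (hsg : s ⊆ g) (hc : s.card < g.card) :
    g \ s ∈ PCMPaper.link s X := by
  have hpos : (g \ s).Nonempty := by
    rw [← Finset.card_pos, Finset.card_sdiff_of_subset hsg]
    omega
  refine ⟨hX.2.2.1 g hg _ hpos Finset.sdiff_subset, Finset.inter_sdiff_self s g, ?_⟩
  rwa [Finset.union_sdiff_of_subset hsg]

lemma card_union_of_mem_link {X : Set (Finset V)} {s h : Finset V} (hh : h ∈ link s X) :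
    (s ∪ h).card = s.card + h.card :=
  Finset.card_union_of_disjoint (Finset.disjoint_iff_inter_eq_empty.2 hh.2.1)

lemma union_sdiff_of_mem_link {X : Set (Finset V)} {s h : Finset V} (hh : h ∈ link s X) :
    (s ∪ h) \ s = h :=
  Finset.union_sdiff_cancel_left (Finset.disjoint_iff_inter_eq_empty.2 hh.2.1)

lemma exists_isChain_of_finset (g : Finset V) : ∃ C : Finset (Finset V),
    (∀ h ∈ C, h.Nonempty ∧ h ⊆ g) ∧ IsChain (· ≤ ·) (C : Set (Finset V)) ∧ C.card = g.card := by
  induction g using Finset.induction_on with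
  | empty => exact ⟨∅, by simp⟩
  | insert a g ha ih =>
    obtain ⟨C, hC, hchain, hcard⟩ := ih
    refine ⟨insert (insert a g) C, ?_, ?_, ?_⟩
    · intro h hh
      rcases Finset.mem_insert.1 hh with rfl | hh
      · exact ⟨Finset.insert_nonempty _ _, subset_rfl⟩
      · exact ⟨(hC h hh).1, (hC h hh).2.trans (Finset.subset_insert _ _)⟩
    · rw [Finset.coe_insert]
      exact hchain.insert fun b hb _ => Or.inr ((hC b hb).2.trans (Finset.subset_insert _ _))
    · rw [Finset.card_insert_of_notMem, Finset.card_insert_of_notMem ha, hcard]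
      exact fun hmem => ha ((hC _ hmem).2 (Finset.mem_insert_self a g))

lemma IsSimplicialComplex.hasHeight {X : Set (Finset V)} {N : ℕ} (hX : IsSimplicialComplex X)
    (hne : X.Nonempty) (hpure : PureCard X N) : HasHeight (N + 1) X := by
  constructor
  · obtain ⟨h, hh⟩ := hne
    obtain ⟨g, hg, -, hc⟩ := hpure h hh
    obtain ⟨C, hC, hchain, hcard⟩ := exists_isChain_of_finset g
    exact ⟨C, fun h hh => hX.2.2.1 g hg h (hC h hh).1 (hC h hh).2, hchain, hcard.trans hc⟩
  · intro C hC hchain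
    rw [← Nat.add_sub_cancel (N + 1) 1, ← Nat.card_Icc]
    refine Finset.card_le_card_of_injOn Finset.card ?_ ?_
    · intro h hh
      have h1 := Finset.card_pos.2 (hX.2.1 h (hC hh))
      have h2 := hpure.card_le (hC hh)
      simp only [Finset.coe_Icc, Set.mem_Icc]
      omega
    · intro a ha b hb hab
      rcases hchain.total ha hb with h | h
      · exact Finset.eq_of_subset_of_card_le h hab.ge
      · exact (Finset.eq_of_subset_of_card_le h hab.le).symm

lemma PureCard.link {X : Set (Finset V)} {N M : ℕ} (hX : IsSimplicialComplex X)
    (hpure : PureCard X N) {s : Finset V} (hM : s.card + M = N) : PureCard (link s X) M := by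
  intro h hh
  obtain ⟨g, hg, hsub, hc⟩ := hpure _ hh.2.2
  have hsg := Finset.subset_union_left.trans hsub
  refine ⟨g \ s, hX.sdiff_mem_link hg hsg (by omega), ?_, ?_⟩
  · rw [← union_sdiff_of_mem_link hh]
    exact Finset.sdiff_subset_sdiff hsub subset_rfl
  · rw [Finset.card_sdiff_of_subset hsg]
    omega

lemma RidgeCondition.link {X : Set (Finset V)} {N M : ℕ} (hX : IsSimplicialComplex X)
    (hridge : RidgeCondition X N) {s : Finset V} (hM : s.card + M = N) :
    RidgeCondition (link s X) M := by
  intro h hh hc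
  have hcard := card_union_of_mem_link hh
  have := hridge _ hh.2.2 (by omega)
  convert this using 1
  have himage : {g | g ∈ X ∧ s ∪ h ⊆ g ∧ g.card = N + 1} =
      (s ∪ ·) '' {g | g ∈ PCMPaper.link s X ∧ h ⊆ g ∧ g.card = M + 1} := by
    ext g
    simp only [Set.mem_ofPred_eq, Set.mem_image]
    constructor
    · rintro ⟨hg, hsub, hgc⟩
      have hsg := Finset.subset_union_left.trans hsub
      refine ⟨g \ s, ⟨hX.sdiff_mem_link hg hsg (by omega), ?_, ?_⟩,
        Finset.union_sdiff_of_subset hsg⟩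
      · rw [← union_sdiff_of_mem_link hh]
        exact Finset.sdiff_subset_sdiff hsub subset_rfl
      · rw [Finset.card_sdiff_of_subset hsg]
        omega
    · rintro ⟨k, ⟨hk, hhk, hkc⟩, rfl⟩
      refine ⟨hk.2.2, Finset.union_subset_union_right hhk, ?_⟩
      have := card_union_of_mem_link hk
      omega
  rw [himage, Set.InjOn.ncard_image]
  intro a ha b hb hab
  rw [← union_sdiff_of_mem_link ha.1, ← union_sdiff_of_mem_link hb.1]
  exact congrArg (· \ s) hab

lemma nConnected_link_iff {X : Set (Finset V)} {N M : ℕ} (hX : IsSimplicialComplex X)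
    {s : Finset V} (hM : s.card + M = N) (hM1 : 1 ≤ M) :
    NConnected (link s X) M ↔ StarConnected X N s := by
  constructor
  · intro h a ha hsa hac b hb hsb hbc
    have key : ∀ g, s ⊆ g → g.card = N + 1 → dim (g \ s) = M := by
      intro g hsg hgc
      rw [dim, Finset.card_sdiff_of_subset hsg]
      omega
    have := h (a \ s) (hX.sdiff_mem_link ha hsa (by omega)) (key a hsa hac)
      (b \ s) (hX.sdiff_mem_link hb hsb (by omega)) (key b hsb hbc)
    rw [← Finset.union_sdiff_of_subset hsa, ← Finset.union_sdiff_of_subset hsb]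
    refine this.lift (s ∪ ·) ?_
    have hmem : ∀ x ∈ {h | h ∈ link s X ∧ (dim h = M - 1 ∨ dim h = M)},
        s ∪ x ∈ {h | h ∈ X ∧ s ⊆ h ∧ (h.card = N ∨ h.card = N + 1)} := by
      rintro x ⟨hx, hxd⟩
      have := card_union_of_mem_link hx
      refine ⟨hx.2.2, Finset.subset_union_left, ?_⟩
      unfold dim at hxd
      omega
    rintro x y ⟨hx, hy, hne, hlt⟩
    refine ⟨hmem x hx, hmem y hy, ?_, ?_⟩
    · intro hxy
      rw [← union_sdiff_of_mem_link hx.1, ← union_sdiff_of_mem_link hy.1] at hne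
      exact hne (congrArg (· \ s) hxy)
    · have hmono : ∀ {x y}, x ∈ link s X → y ∈ link s X → x < y → s ∪ x < s ∪ y := by
        intro x y hx hy hlt
        refine lt_of_le_of_ne (Finset.union_subset_union_right hlt.le) fun hxy => hlt.ne ?_
        rw [← union_sdiff_of_mem_link hx, ← union_sdiff_of_mem_link hy, hxy]
      exact hlt.imp (hmono hx.1 hy.1) (hmono hy.1 hx.1)
  · intro h a ha hac b hb hbc
    have ha' := card_union_of_mem_link ha
    have hb' := card_union_of_mem_link hb
    unfold dim at hac hbc
    have := h (s ∪ a) ha.2.2 Finset.subset_union_left (by omega)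
      (s ∪ b) hb.2.2 Finset.subset_union_left (by omega)
    rw [← union_sdiff_of_mem_link ha, ← union_sdiff_of_mem_link hb]
    refine this.lift (· \ s) ?_
    have hmem : ∀ x ∈ {h | h ∈ X ∧ s ⊆ h ∧ (h.card = N ∨ h.card = N + 1)},
        x \ s ∈ {h | h ∈ link s X ∧ (dim h = M - 1 ∨ dim h = M)} := by
      rintro x ⟨hx, hsx, hxd⟩
      refine ⟨hX.sdiff_mem_link hx hsx (by omega), ?_⟩
      rw [dim, Finset.card_sdiff_of_subset hsx]
      omega
    have hinj : ∀ {x y : Finset V}, s ⊆ x → s ⊆ y → x \ s = y \ s → x = y := by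
      intro x y hx hy hxy
      rw [← Finset.union_sdiff_of_subset hx, hxy, Finset.union_sdiff_of_subset hy]
    have hmono : ∀ {x y : Finset V}, s ⊆ x → s ⊆ y → x < y → x \ s < y \ s := fun hx hy hlt =>
      lt_of_le_of_ne (Finset.sdiff_subset_sdiff hlt.le subset_rfl) fun hxy =>
        hlt.ne (hinj hx hy hxy)
    rintro x y ⟨hx, hy, hne, hlt⟩
    exact ⟨hmem x hx, hmem y hy, fun h => hne (hinj hx.2.1 hy.2.1 h),
      hlt.imp (hmono hx.2.1 hy.2.1) (hmono hy.2.1 hx.2.1)⟩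

lemma isPseudomanifold_iff {X : Set (Finset V)} {N : ℕ} (hX : IsSimplicialComplex X)
    (hne : X.Nonempty) (hpure : PureCard X N) (hN : 1 ≤ N) :
    IsPseudomanifold X N ↔ RidgeCondition X N ∧ NConnected X N := by
  rw [ridgeCondition_iff]
  constructor
  · rintro ⟨-, -, ⟨h, -⟩ | ⟨-, -, hridge, hconn⟩⟩
    · omega
    · exact ⟨hridge, hconn⟩
  · rintro ⟨hridge, hconn⟩
    exact ⟨hX, (hX.hasHeight hne hpure).rankSet_eq,
      Or.inr ⟨by exact_mod_cast hN, pure_iff.2 hpure, hridge, hconn⟩⟩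

lemma isNormalPseudomanifold_iff {X : Set (Finset V)} {N : ℕ} (hX : IsSimplicialComplex X)
    (hne : X.Nonempty) (hpure : PureCard X N) (hN : 1 ≤ N) :
    IsNormalPseudomanifold X N ↔ RidgeCondition X N ∧
      ∀ s, s ∈ X ∨ s = ∅ → s.card < N → StarConnected X N s := by
  have hlink : ∀ s, s ∈ X ∨ s = ∅ → ∀ M, s.card + M = N → 1 ≤ M →
      (IsPseudomanifold (link s X) M ↔ RidgeCondition (link s X) M ∧ StarConnected X N s) := by
    intro s hs M hM hM1
    rw [isPseudomanifold_iff (hX.link s) ?_ (hpure.link hX hM) hM1, nConnected_link_iff hX hM hM1]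
    obtain ⟨g, hg, hsg, hc⟩ := hpure.exists_facet hne hs
    exact ⟨_, hX.sdiff_mem_link hg hsg (by omega)⟩
  have hempty := hlink ∅ (Or.inr rfl) N (by simp) hN
  rw [link_empty] at hempty
  rw [IsNormalPseudomanifold, hempty]
  constructor
  · rintro ⟨⟨hridge, hconn⟩, hl⟩
    refine ⟨hridge, fun s hs hc => ?_⟩
    rcases hs with hs | rfl
    · have hdim : (N : ℤ) - dim s - 1 = ((N - s.card : ℕ) : ℤ) := by unfold dim; omega
      have := hl s hs (by unfold dim; omega)
      rw [hdim, hlink s (Or.inl hs) _ (by omega) (by omega)] at this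
      exact this.2
    · exact hconn
  · rintro ⟨hridge, hconn⟩
    refine ⟨⟨hridge, hconn ∅ (Or.inr rfl) (by rw [Finset.card_empty]; omega)⟩, fun s hs hc => ?_⟩
    have hdim : (N : ℤ) - dim s - 1 = ((N - s.card : ℕ) : ℤ) := by unfold dim at hc ⊢; omega
    unfold dim at hc
    rw [hdim, hlink s (Or.inl hs) _ (by omega) (by omega)]
    exact ⟨hridge.link hX (by omega), hconn s (Or.inl hs) (by omega)⟩

lemma isGSurfaceAux_iff_isNormalPseudomanifold {X : Set (Finset V)} {N : ℕ}
    (hX : IsSimplicialComplex X) (hne : X.Nonempty) (hpure : PureCard X N) (hN : 1 ≤ N) :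
    IsGSurfaceAux (N + 1) X ↔ IsNormalPseudomanifold X N := by
  rw [isNormalPseudomanifold_iff hX hne hpure hN]
  constructor
  · intro hG
    have hG' : ∀ (m : ℕ) (s : Finset V), s ∈ X ∨ s = ∅ → s.card + m = N + 1 →
        IsGSurfaceAux m (betaS X s) := fun m s hs hm =>
      isGSurfaceAux_betaS_of_isGSurfaceAux hX hG hs rfl hm
    exact ⟨.of_isGSurfaceAux hpure fun s hs hc => hG' 1 s (Or.inl hs) (by omega),
      fun s hs hc => starConnected_of_isGSurfaceAux hpure hN hG' (m := N + 1 - s.card) hs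
        (by omega)⟩
  · rintro ⟨hridge, hstar⟩
    rw [← hX.betaS_empty]
    exact isGSurfaceAux_betaS hX hne hpure hN hridge hstar (Or.inr rfl) (by simp)

end Simplicial

/-- Let `X` be a pure simplicial complex of rank `n ≥ 2`.  Then:
(1) if `ΔX = ∅`, `X` is an `n`-surface iff it is a normal pseudomanifold of rank `n`;
(2) if `ΔX ≠ ∅`, `X` is an `n`-PCM iff it is a normal pseudomanifold of rank `n`. -/
theorem statement_18 {V : Type*} [DecidableEq V] (X : Set (Finset V)) (n : ℤ) (hn : 2 ≤ n)
    (hsc : IsSimplicialComplex X) (hrk : rankSet X = n) (hpure : Pure X n) :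
    (border X = ∅ → (IsSurface n X ↔ IsNormalPseudomanifold X n)) ∧
    (border X ≠ ∅ → (IsPCM n X ↔ IsNormalPseudomanifold X n)) := by
  obtain ⟨m, rfl⟩ : ∃ m : ℕ, n = ((m + 1 : ℕ) : ℤ) := ⟨(n - 1).toNat, by omega⟩
  have hne : X.Nonempty := by
    rw [Set.nonempty_iff_ne_empty]
    rintro rfl
    simp only [rankSet, if_true] at hrk
    omega
  rw [← isGSurfaceAux_iff_isNormalPseudomanifold hsc hne (pure_iff.1 hpure) (by omega),
    isGSurfaceAux_iff, isSurface_iff (m := m + 2) (by push_cast; ring),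
    isPCM_iff (m := m + 2) (by push_cast; ring)]
  refine ⟨fun hb => ⟨Or.inr, fun h => h.resolve_left fun hP => hP.2.2.1 hb⟩,
    fun hb => ⟨Or.inl, fun h => h.resolve_right fun hS => ?_⟩⟩
  obtain ⟨x, hx⟩ := Set.nonempty_iff_ne_empty.2 hb
  rw [mem_border_iff hrk] at hx
  exact hx.2 (hS.2.2 x hx.1)

end PCMPaper
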